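/- arXiv:math/0108120 — 2 statements merged into one kernel-verified Lean document; each statement's English description precedes it below -/
import Mathlib

section
/- Let d ≥ 1 and β > 0. There exist constants 0 < b₁ < b₂ < ∞ (possibly depending on β) such that E₀(e^{−β J_n} · 1{J_n ∉ [b₁ n, b₂ n]}) = o(E₀(e^{−β J_n})) as n → ∞; equivalently, the weakly self-avoiding walk satisfies Q_n^β(b₁ n ≤ J_n ≤ b₂ n) → 1 as n → ∞. In particular, the expected self-intersection local time of the weakly self-avoiding walk is of order n. -/
open Filter

/-- A single step in `ℤ^d`: a coordinate direction together with a sign,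
so that there are exactly `2d` possible steps. -/
def stepVec (d : ℕ) (s : Fin d × Bool) (k : Fin d) : ℤ :=
  if k = s.1 then (if s.2 then 1 else -1) else 0

/-- An `n`-step nearest-neighbour path in `ℤ^d` starting at the origin,
encoded by its sequence of steps. -/
abbrev Walk (d n : ℕ) := Fin n → Fin d × Bool

/-- The position `S(i)` of the walk after `i` steps. -/
def walkPos {d n : ℕ} (w : Walk d n) (i : ℕ) : Fin d → ℤ :=
  fun k => ∑ j ∈ Finset.filter (fun j : Fin n => (j : ℕ) < i) Finset.univ, stepVec d (w j) k

/-- The self-intersection local time `J_n = #{(i,j) : 0 ≤ i < j ≤ n, S(i) = S(j)}`. -/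
def silt {d n : ℕ} (w : Walk d n) : ℕ :=
  (((Finset.range (n+1)) ×ˢ (Finset.range (n+1))).filter
    (fun p => p.1 < p.2 ∧ walkPos w p.1 = walkPos w p.2)).card

/-- The Euclidean distance `χ_n = ‖S(n)‖₂` of the endpoint from the origin. -/
noncomputable def chi {d n : ℕ} (w : Walk d n) : ℝ :=
  Real.sqrt (∑ k : Fin d, ((walkPos w n k : ℝ))^2)

/-- Expectation `E₀` under the uniform measure on the `(2d)^n` `n`-step paths. -/
noncomputable def E0 (d n : ℕ) (f : Walk d n → ℝ) : ℝ :=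
  (∑ w : Walk d n, f w) / ((2*d : ℝ))^n

/-- Expectation `E_β` with respect to the weakly self-avoiding walk measure
`Q_n^β(A) = E₀(e^{-β J_n} 1_A)/E₀(e^{-β J_n})`. -/
noncomputable def Ewsaw (d n : ℕ) (β : ℝ) (f : Walk d n → ℝ) : ℝ :=
  (∑ w : Walk d n, Real.exp (-β * (silt w : ℝ)) * f w) /
    (∑ w : Walk d n, Real.exp (-β * (silt w : ℝ)))

/-- The exponent `μ(d)`: `μ(1) = 1` and `μ(d) = max(1/2, 1/4 + 1/d)` for `d ≥ 2`. -/
noncomputable def mu (d : ℕ) : ℝ :=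
  if d = 1 then 1 else max (1/2) (1/4 + 1/(d : ℝ))

section Walks

variable {d n : ℕ}

/-- The step opposite to `s`. -/
def revStep (s : Fin d × Bool) : Fin d × Bool := (s.1, !s.2)

lemma stepVec_revStep (s : Fin d × Bool) (k : Fin d) :
    stepVec d (revStep s) k = -stepVec d s k := by
  rcases s with ⟨a, b⟩
  cases b <;> simp [stepVec, revStep] <;> split_ifs <;> simp

lemma walkPos_zero (w : Walk d n) (k : Fin d) : walkPos w 0 k = 0 := by
  simp [walkPos]

lemma walkPos_succ (w : Walk d n) {i : ℕ} (hi : i < n) (k : Fin d) :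
    walkPos w (i + 1) k = walkPos w i k + stepVec d (w ⟨i, hi⟩) k := by
  unfold walkPos
  have h : Finset.filter (fun j : Fin n => (j : ℕ) < i + 1) Finset.univ =
      insert ⟨i, hi⟩ (Finset.filter (fun j : Fin n => (j : ℕ) < i) Finset.univ) := by
    ext j
    simp only [Finset.mem_filter, Finset.mem_univ, true_and, Finset.mem_insert, Fin.ext_iff]
    omega
  rw [h, Finset.sum_insert (by simp), add_comm]

/-- The set of pairs of times counted by `silt`. -/
def siltPairs (w : Walk d n) : Finset (ℕ × ℕ) :=
  ((Finset.range (n+1)) ×ˢ (Finset.range (n+1))).filter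
    (fun p => p.1 < p.2 ∧ walkPos w p.1 = walkPos w p.2)

lemma card_siltPairs (w : Walk d n) : (siltPairs w).card = silt w := rfl

lemma mem_siltPairs {w : Walk d n} {a b : ℕ} :
    (a, b) ∈ siltPairs w ↔ b ≤ n ∧ a < b ∧ walkPos w a = walkPos w b := by
  simp only [siltPairs, Finset.mem_filter, Finset.mem_product, Finset.mem_range]
  constructor
  · rintro ⟨⟨_, h⟩, h', e⟩
    exact ⟨by omega, h', e⟩
  · rintro ⟨h, h', e⟩
    exact ⟨⟨by omega, by omega⟩, h', e⟩

/-- The walk that traverses its `i`-th edge forwards, backwards and forwards again. -/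
def insertLoop (w : Walk d n) (i : Fin n) : Walk d (n + 2) := fun t =>
  if h : (t : ℕ) ≤ i then w ⟨t, by omega⟩
  else if (t : ℕ) = i + 1 then revStep (w i)
  else w ⟨t - 2, by omega⟩

/-- The time of `w` corresponding to time `t` of `insertLoop w i`. -/
def loopTime (i t : ℕ) : ℕ := if t ≤ i + 1 then t else t - 2

lemma walkPos_insertLoop (w : Walk d n) (i : Fin n) (t : ℕ) (ht : t ≤ n + 2) :
    walkPos (insertLoop w i) t = walkPos w (loopTime i t) := by
  have hi := i.isLt
  induction t with
  | zero => ext k; simp [loopTime, walkPos_zero]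
  | succ t ih =>
    specialize ih (by omega)
    ext k
    rw [walkPos_succ _ (show t < n + 2 by omega), ih]
    rcases lt_trichotomy t (i + 1) with h | h | h
    · have e1 : loopTime i t = t := by simp [loopTime]; omega
      have e2 : loopTime i (t + 1) = t + 1 := by simp [loopTime]; omega
      rw [e1, e2, walkPos_succ w (show t < n by omega)]
      simp [insertLoop, show t ≤ (i : ℕ) by omega]
    · subst h
      have e1 : loopTime i ((i : ℕ) + 1) = i + 1 := by simp [loopTime]
      have e2 : loopTime i ((i : ℕ) + 1 + 1) = i := by simp [loopTime]
      rw [e1, e2, walkPos_succ w hi]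
      simp [insertLoop, stepVec_revStep]
    · obtain ⟨s, rfl⟩ : ∃ s, t = s + 2 := ⟨t - 2, by omega⟩
      have e1 : loopTime i (s + 2) = s := by simp [loopTime]; omega
      have e2 : loopTime i (s + 2 + 1) = s + 1 := by simp [loopTime]; omega
      rw [e1, e2, walkPos_succ w (show s < n by omega)]
      simp [insertLoop, show ¬ s + 2 ≤ (i : ℕ) by omega, show ¬ s + 1 = (i : ℕ) by omega]

lemma insertLoop_left_injective (i : Fin n) :
    Function.Injective (fun w : Walk d n => insertLoop w i) := by
  intro v w h
  ext1 t
  by_cases ht : (t : ℕ) ≤ i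
  · have := congrFun h ⟨t, by omega⟩
    simpa [insertLoop, ht] using this
  · have := congrFun h ⟨t + 2, by omega⟩
    simpa [insertLoop, show ¬ (t : ℕ) + 2 ≤ i by omega, show ¬ (t : ℕ) + 1 = i by omega] using this

/-- The times whose position is visited by `w` at another time as well. -/
def multiTimes (w : Walk d n) : Finset ℕ :=
  (siltPairs w).image Prod.fst ∪ (siltPairs w).image Prod.snd

lemma fst_mem_multiTimes {w : Walk d n} {a b : ℕ} (h : (a, b) ∈ siltPairs w) :
    a ∈ multiTimes w :=
  Finset.mem_union_left _ (Finset.mem_image_of_mem Prod.fst h)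

lemma snd_mem_multiTimes {w : Walk d n} {a b : ℕ} (h : (a, b) ∈ siltPairs w) :
    b ∈ multiTimes w :=
  Finset.mem_union_right _ (Finset.mem_image_of_mem Prod.snd h)

lemma card_multiTimes_le (w : Walk d n) : (multiTimes w).card ≤ 2 * silt w := by
  refine (Finset.card_union_le _ _).trans ?_
  have h1 := Finset.card_image_le (s := siltPairs w) (f := Prod.fst)
  have h2 := Finset.card_image_le (s := siltPairs w) (f := Prod.snd)
  rw [card_siltPairs] at h1 h2
  omega

/-- The indices of the edges of `w` both of whose endpoints are visited exactly once. -/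
def simpleEdges (w : Walk d n) : Finset (Fin n) :=
  Finset.univ.filter fun i => (i : ℕ) ∉ multiTimes w ∧ (i : ℕ) + 1 ∉ multiTimes w

lemma le_card_simpleEdges (w : Walk d n) : n ≤ (simpleEdges w).card + 4 * silt w := by
  have h := Finset.card_filter_add_card_filter_not (s := (Finset.univ : Finset (Fin n)))
    (fun i => (i : ℕ) ∉ multiTimes w ∧ (i : ℕ) + 1 ∉ multiTimes w)
  rw [Finset.card_univ, Fintype.card_fin] at h
  have h1 : (Finset.univ.filter fun i : Fin n =>
      ¬((i : ℕ) ∉ multiTimes w ∧ (i : ℕ) + 1 ∉ multiTimes w)) ⊆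
      (Finset.univ.filter fun i : Fin n => (i : ℕ) ∈ multiTimes w) ∪
      (Finset.univ.filter fun i : Fin n => (i : ℕ) + 1 ∈ multiTimes w) := by
    intro i
    simp only [Finset.mem_filter, Finset.mem_univ, true_and, Finset.mem_union]
    tauto
  have h2 := (Finset.card_le_card h1).trans (Finset.card_union_le _ _)
  have h3 : (Finset.univ.filter fun i : Fin n => (i : ℕ) ∈ multiTimes w).card ≤
      (multiTimes w).card :=
    Finset.card_le_card_of_injOn (fun i => (i : ℕ)) (fun i hi => by simpa using hi)
      (fun a _ b _ h => by simpa [Fin.ext_iff] using h)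
  have h4 : (Finset.univ.filter fun i : Fin n => (i : ℕ) + 1 ∈ multiTimes w).card ≤
      (multiTimes w).card :=
    Finset.card_le_card_of_injOn (fun i => (i : ℕ) + 1) (fun i hi => by simpa using hi)
      (fun a _ b _ h => by simpa [Fin.ext_iff] using h)
  have h5 := card_multiTimes_le w
  unfold simpleEdges
  omega

lemma silt_insertLoop_le (w : Walk d n) {i : Fin n} (hi : i ∈ simpleEdges w) :
    silt (insertLoop w i) ≤ silt w + 2 := by
  have hin := i.isLt
  simp only [simpleEdges, Finset.mem_filter, Finset.mem_univ, true_and] at hi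
  obtain ⟨hi0, hi1⟩ := hi
  let g : ℕ → ℕ := fun t => if t < i then t else t + 2
  have hsub : siltPairs (insertLoop w i) ⊆
      (siltPairs w).image (fun p => (g p.1, g p.2)) ∪
        {((i : ℕ), (i : ℕ) + 2), ((i : ℕ) + 1, (i : ℕ) + 3)} := by
    rintro ⟨a, b⟩ hab
    obtain ⟨hb, hlt, he⟩ := mem_siltPairs.1 hab
    rw [walkPos_insertLoop w i a (by omega), walkPos_insertLoop w i b hb] at he
    have hmem : ∀ x y, x < y → y ≤ n → walkPos w x = walkPos w y →
        (x, y) ∈ siltPairs w ∧ x ≠ i ∧ x ≠ i + 1 ∧ y ≠ i ∧ y ≠ i + 1 := by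
      intro x y hxy hy e
      have hp : (x, y) ∈ siltPairs w := mem_siltPairs.2 ⟨hy, hxy, e⟩
      have hx' := fst_mem_multiTimes hp
      have hy' := snd_mem_multiTimes hp
      refine ⟨hp, ?_, ?_, ?_, ?_⟩ <;> rintro rfl <;> contradiction
    have hbn : loopTime i b ≤ n := by unfold loopTime; split_ifs <;> omega
    have han : loopTime i a ≤ n := by unfold loopTime; split_ifs <;> omega
    simp only [Finset.mem_union, Finset.mem_image, Finset.mem_insert, Finset.mem_singleton,
      Prod.mk.injEq, Prod.exists]
    rcases lt_trichotomy (loopTime i a) (loopTime i b) with h | h | h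
    · obtain ⟨hp, h1, h2, h3, h4⟩ := hmem _ _ h hbn he
      refine Or.inl ⟨_, _, hp, ?_, ?_⟩ <;>
      · simp only [g]
        unfold loopTime at *
        split_ifs at * <;> omega
    · right
      unfold loopTime at h
      split_ifs at h <;> omega
    · obtain ⟨hp, h1, h2, h3, h4⟩ := hmem _ _ h han he.symm
      exfalso
      unfold loopTime at *
      split_ifs at * <;> omega
  have h := (Finset.card_le_card hsub).trans (Finset.card_union_le _ _)
  have h1 := Finset.card_image_le (s := siltPairs w) (f := fun p => (g p.1, g p.2))
  have h2 := Finset.card_le_two (a := ((i : ℕ), (i : ℕ) + 2)) (b := ((i : ℕ) + 1, (i : ℕ) + 3))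
  rw [card_siltPairs] at h h1
  omega

/-- The times at which `w` is about to make an immediate reversal. -/
def reversals (w : Walk d (n + 2)) : Finset (Fin n) :=
  Finset.univ.filter fun i => walkPos w i = walkPos w (i + 2)

lemma card_reversals_le (w : Walk d (n + 2)) : (reversals w).card ≤ silt w := by
  rw [← card_siltPairs]
  refine Finset.card_le_card_of_injOn (fun i => ((i : ℕ), (i : ℕ) + 2)) (fun i hi => ?_)
    (fun a _ b _ h => by simpa [Fin.ext_iff] using h)
  have hi' : walkPos w i = walkPos w (i + 2) := by simpa [reversals] using hi
  exact mem_siltPairs.2 ⟨by omega, by omega, hi'⟩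

lemma mem_reversals_insertLoop (w : Walk d n) (i : Fin n) :
    i ∈ reversals (insertLoop w i) := by
  have hi := i.isLt
  simp only [reversals, Finset.mem_filter, Finset.mem_univ, true_and]
  rw [walkPos_insertLoop w i _ (by omega), walkPos_insertLoop w i _ (by omega)]
  simp [loopTime]

lemma walkPos_snoc (w : Walk d n) (s : Fin d × Bool) (t : ℕ) (ht : t ≤ n) :
    walkPos (Fin.snoc w s : Walk d (n + 1)) t = walkPos w t := by
  induction t with
  | zero => ext k; simp [walkPos_zero]
  | succ t ih =>
    ext k
    rw [walkPos_succ _ (show t < n + 1 by omega), walkPos_succ w (show t < n by omega),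
      ih (by omega)]
    simp [Fin.snoc, show t < n by omega]

lemma silt_le_silt_snoc (w : Walk d n) (s : Fin d × Bool) :
    silt w ≤ silt (Fin.snoc w s : Walk d (n + 1)) := by
  rw [← card_siltPairs, ← card_siltPairs]
  refine Finset.card_le_card ?_
  rintro ⟨a, b⟩ hab
  obtain ⟨hb, hlt, he⟩ := mem_siltPairs.1 hab
  refine mem_siltPairs.2 ⟨by omega, hlt, ?_⟩
  rwa [walkPos_snoc w s a (by omega), walkPos_snoc w s b hb]

lemma silt_straight (n : ℕ) (k : Fin d) : silt (fun _ => (k, true) : Walk d n) = 0 := by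
  have hpos : ∀ t ≤ n, walkPos (fun _ => (k, true) : Walk d n) t k = t := by
    intro t
    induction t with
    | zero => simp [walkPos_zero]
    | succ t ih =>
      intro ht
      rw [walkPos_succ _ (show t < n by omega), ih (by omega)]
      simp [stepVec]
  rw [← card_siltPairs, Finset.card_eq_zero, Finset.eq_empty_iff_forall_notMem]
  rintro ⟨a, b⟩ hab
  obtain ⟨hb, hlt, he⟩ := mem_siltPairs.1 hab
  have := congrFun he k
  rw [hpos a (by omega), hpos b hb] at this
  omega

end Walks

section PartitionFunctions

/-- The unnormalised partition function of the weakly self-avoiding walk. -/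
noncomputable def wsawZ (d n : ℕ) (β : ℝ) : ℝ :=
  ∑ w : Walk d n, Real.exp (-β * (silt w : ℝ))

/-- The part of the partition function carried by walks with at most `j` self-intersections. -/
noncomputable def wsawLow (d n j : ℕ) (β : ℝ) : ℝ :=
  ∑ w : Walk d n with silt w ≤ j, Real.exp (-β * (silt w : ℝ))

variable {d : ℕ} {β : ℝ}

lemma wsawLow_le_wsawZ (n j : ℕ) : wsawLow d n j β ≤ wsawZ d n β :=
  Finset.sum_le_sum_of_subset_of_nonneg (Finset.filter_subset _ _)
    (fun _ _ _ => (Real.exp_pos _).le)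

lemma wsawLow_nonneg (n j : ℕ) : 0 ≤ wsawLow d n j β :=
  Finset.sum_nonneg fun _ _ => (Real.exp_pos _).le

lemma one_le_wsawZ (hd : 1 ≤ d) (n : ℕ) : 1 ≤ wsawZ d n β := by
  have h := Finset.single_le_sum (s := Finset.univ)
    (f := fun w : Walk d n => Real.exp (-β * (silt w : ℝ)))
    (fun _ _ => (Real.exp_pos _).le) (Finset.mem_univ (fun _ => ((⟨0, hd⟩ : Fin d), true)))
  simpa [silt_straight, wsawZ] using h

lemma wsawZ_succ_le (hβ : 0 < β) (n : ℕ) :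
    wsawZ d (n + 1) β ≤ 2 * d * wsawZ d n β := by
  unfold wsawZ
  rw [← (Fin.snocEquiv (fun _ : Fin (n + 1) => Fin d × Bool)).sum_comp, Fintype.sum_prod_type]
  have hle : ∀ s : Fin d × Bool, ∑ w : Walk d n,
      Real.exp (-β * (silt ((Fin.snocEquiv (fun _ : Fin (n + 1) => Fin d × Bool)) (s, w)) : ℝ)) ≤
      ∑ w : Walk d n, Real.exp (-β * (silt w : ℝ)) := by
    intro s
    refine Finset.sum_le_sum fun w _ => Real.exp_le_exp.2 ?_
    have h : (silt w : ℝ) ≤ silt (Fin.snoc w s : Walk d (n + 1)) := by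
      exact_mod_cast silt_le_silt_snoc w s
    exact mul_le_mul_of_nonpos_left h (by linarith)
  refine (Finset.sum_le_sum fun s _ => hle s).trans (le_of_eq ?_)
  simp [mul_comm]

lemma wsawZ_add_le (hβ : 0 < β) (n m : ℕ) :
    wsawZ d (n + m) β ≤ (2 * d) ^ m * wsawZ d n β := by
  induction m with
  | zero => simp
  | succ m ih =>
    calc wsawZ d (n + m + 1) β ≤ 2 * d * wsawZ d (n + m) β := wsawZ_succ_le hβ _
      _ ≤ 2 * d * ((2 * d) ^ m * wsawZ d n β) := by gcongr
      _ = _ := by ring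

lemma wsawLow_insertLoop (hβ : 0 < β) (n j : ℕ) :
    ((n : ℝ) - 4 * j) * wsawLow d n j β ≤
      Real.exp (2 * β) * (j + 2) * wsawLow d (n + 2) (j + 2) β := by
  let s : Finset (Σ _ : Walk d n, Fin n) :=
    (Finset.univ.filter fun w : Walk d n => silt w ≤ j).sigma fun w => simpleEdges w
  let t : Finset (Σ _ : Walk d (n + 2), Fin n) :=
    (Finset.univ.filter fun w : Walk d (n + 2) => silt w ≤ j + 2).sigma fun w => reversals w
  let F : (Σ _ : Walk d n, Fin n) → Σ _ : Walk d (n + 2), Fin n :=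
    fun p => ⟨insertLoop p.1 p.2, p.2⟩
  have hF : Function.Injective F := by
    rintro ⟨v, i⟩ ⟨w, k⟩ h
    simp only [F, Sigma.mk.injEq, heq_eq_eq] at h
    obtain ⟨h, rfl⟩ := h
    rw [insertLoop_left_injective i h]
  have hst : s.image F ⊆ t := by
    intro q hq
    obtain ⟨⟨w, i⟩, hp, rfl⟩ := Finset.mem_image.1 hq
    simp only [s, Finset.mem_sigma, Finset.mem_filter, Finset.mem_univ, true_and] at hp
    simp only [t, F, Finset.mem_sigma, Finset.mem_filter, Finset.mem_univ, true_and]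
    exact ⟨(silt_insertLoop_le w hp.2).trans (by omega), mem_reversals_insertLoop w i⟩
  have hlow : ((n : ℝ) - 4 * j) * wsawLow d n j β ≤
      ∑ p ∈ s, Real.exp (-β * (silt p.1 : ℝ)) := by
    rw [Finset.sum_sigma, wsawLow, Finset.mul_sum]
    refine Finset.sum_le_sum fun w hw => ?_
    simp only [Finset.sum_const, nsmul_eq_mul]
    refine mul_le_mul_of_nonneg_right ?_ (Real.exp_pos _).le
    have hw' : (silt w : ℝ) ≤ j := by exact_mod_cast (Finset.mem_filter.1 hw).2
    have h : (n : ℝ) ≤ (simpleEdges w).card + 4 * silt w := by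
      exact_mod_cast le_card_simpleEdges w
    linarith
  have hmid : ∑ p ∈ s, Real.exp (-β * (silt p.1 : ℝ)) ≤
      Real.exp (2 * β) * ∑ q ∈ t, Real.exp (-β * (silt q.1 : ℝ)) := by
    calc ∑ p ∈ s, Real.exp (-β * (silt p.1 : ℝ))
        ≤ ∑ p ∈ s, Real.exp (2 * β) * Real.exp (-β * (silt (F p).1 : ℝ)) := by
          refine Finset.sum_le_sum fun p hp => ?_
          rw [← Real.exp_add]
          refine Real.exp_le_exp.2 ?_
          have h : (silt (F p).1 : ℝ) ≤ silt p.1 + 2 := by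
            exact_mod_cast silt_insertLoop_le p.1 (Finset.mem_sigma.1 hp).2
          nlinarith
      _ = Real.exp (2 * β) * ∑ q ∈ s.image F, Real.exp (-β * (silt q.1 : ℝ)) := by
          rw [Finset.sum_image hF.injOn, Finset.mul_sum]
      _ ≤ _ := by
          gcongr
  have hup : ∑ q ∈ t, Real.exp (-β * (silt q.1 : ℝ)) ≤
      (j + 2) * wsawLow d (n + 2) (j + 2) β := by
    rw [Finset.sum_sigma, wsawLow, Finset.mul_sum]
    refine Finset.sum_le_sum fun w hw => ?_
    simp only [Finset.sum_const, nsmul_eq_mul]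
    refine mul_le_mul_of_nonneg_right ?_ (Real.exp_pos _).le
    exact_mod_cast (card_reversals_le w).trans (Finset.mem_filter.1 hw).2
  calc _ ≤ _ := hlow
    _ ≤ _ := hmid
    _ ≤ Real.exp (2 * β) * ((j + 2) * wsawLow d (n + 2) (j + 2) β) := by gcongr
    _ = _ := by ring

lemma wsawLow_iterate (hβ : 0 < β) {M : ℕ}
    (hM : 2 * (2 * d) ^ 2 * Real.exp (2 * β) + 4 ≤ M) (m : ℕ) :
    ∀ n j : ℕ, M * (j + 2 * m) ≤ n →
      (2 * (2 * d) ^ 2 : ℝ) ^ m * wsawLow d n j β ≤ wsawLow d (n + 2 * m) (j + 2 * m) β := by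
  induction m with
  | zero => simp
  | succ m ih =>
    intro n j h
    have hnj : (M : ℝ) * (j + 2) ≤ n := by
      have : M * (j + 2) ≤ n := le_trans (Nat.mul_le_mul_left M (by omega)) h
      exact_mod_cast this
    have hM' : (2 * (2 * d) ^ 2 * Real.exp (2 * β) + 4) * ((j : ℝ) + 2) ≤ n :=
      le_trans (by gcongr) hnj
    have hstep := wsawLow_insertLoop (d := d) hβ n j
    have h0 : 0 ≤ wsawLow d n j β := wsawLow_nonneg n j
    have hE := Real.exp_pos (2 * β)
    have hone : (2 * (2 * d) ^ 2 : ℝ) * wsawLow d n j β ≤ wsawLow d (n + 2) (j + 2) β := by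
      have hpos : 0 < Real.exp (2 * β) * ((j : ℝ) + 2) := by positivity
      refine le_of_mul_le_mul_left ?_ hpos
      refine le_trans ?_ hstep
      rw [← mul_assoc]
      refine mul_le_mul_of_nonneg_right ?_ h0
      linarith
    have hnext := ih (n + 2) (j + 2) (by
      have : M * (j + 2 + 2 * m) = M * (j + 2 * (m + 1)) := by ring
      omega)
    calc (2 * (2 * d) ^ 2 : ℝ) ^ (m + 1) * wsawLow d n j β
        = (2 * (2 * d) ^ 2 : ℝ) ^ m * ((2 * (2 * d) ^ 2) * wsawLow d n j β) := by ring
      _ ≤ (2 * (2 * d) ^ 2 : ℝ) ^ m * wsawLow d (n + 2) (j + 2) β := by gcongr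
      _ ≤ _ := hnext
      _ = _ := by
        rw [show n + 2 + 2 * m = n + 2 * (m + 1) by ring,
          show j + 2 + 2 * m = j + 2 * (m + 1) by ring]

lemma wsawLow_le_half_pow (hd : 1 ≤ d) (hβ : 0 < β) {M : ℕ}
    (hM : 2 * (2 * d) ^ 2 * Real.exp (2 * β) + 4 ≤ M) {n j m : ℕ} (h : M * (j + 2 * m) ≤ n) :
    wsawLow d n j β ≤ (1 / 2) ^ m * wsawZ d n β := by
  have h1 := wsawLow_iterate hβ hM m n j h
  have h2 := wsawLow_le_wsawZ (d := d) (β := β) (n + 2 * m) (j + 2 * m)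
  have h3 := wsawZ_add_le (d := d) hβ n (2 * m)
  have hd' : (0 : ℝ) < d := by exact_mod_cast hd
  have hpos : (0 : ℝ) < (2 * (2 * d) ^ 2) ^ m := by positivity
  refine le_of_mul_le_mul_left ((h1.trans h2).trans (h3.trans (le_of_eq ?_))) hpos
  rw [← mul_assoc, ← mul_pow, pow_mul]
  congr 2
  ring

lemma sum_exp_silt_gt_le (hd : 1 ≤ d) {b : ℝ} (hb : Real.log (2 * d) + 1 ≤ β * b) (hβ : 0 < β)
    (n : ℕ) :
    ∑ w : Walk d n with b * n < silt w, Real.exp (-β * (silt w : ℝ)) ≤ Real.exp (-1) ^ n := by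
  have hd' : (0 : ℝ) < 2 * d := by
    have : (0 : ℝ) < d := by exact_mod_cast hd
    positivity
  calc ∑ w : Walk d n with b * n < silt w, Real.exp (-β * (silt w : ℝ))
      ≤ ∑ w : Walk d n with b * n < silt w, (Real.exp (-1) / (2 * d)) ^ n := by
        refine Finset.sum_le_sum fun w hw => ?_
        have hw' := (Finset.mem_filter.1 hw).2
        have hn : (0 : ℝ) ≤ n := Nat.cast_nonneg n
        rw [← Real.exp_log hd', ← Real.exp_sub, ← Real.exp_nat_mul]
        refine Real.exp_le_exp.2 ?_
        nlinarith
    _ ≤ ∑ w : Walk d n, (Real.exp (-1) / (2 * d)) ^ n :=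
        Finset.sum_le_sum_of_subset_of_nonneg (Finset.filter_subset _ _)
          (fun _ _ _ => by positivity)
    _ = Real.exp (-1) ^ n := by
        simp only [Finset.sum_const, Finset.card_univ, Fintype.card_fun, Fintype.card_prod,
          Fintype.card_fin, Fintype.card_bool, nsmul_eq_mul]
        push_cast
        rw [← mul_pow, mul_comm (d : ℝ) 2, mul_div_cancel₀ _ hd'.ne']

end PartitionFunctions

/-- there are `0 < b₁ < b₂ < ∞` such that
`E₀(e^{-βJ_n} 1{J_n ∉ [b₁n, b₂n]}) = o(E₀(e^{-βJ_n}))`; equivalently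
`Q_n^β(b₁ n ≤ J_n ≤ b₂ n) → 1` as `n → ∞`. -/
theorem wsaw_silt_linear (d : ℕ) (hd : 1 ≤ d) (β : ℝ) (hβ : 0 < β) :
    ∃ b₁ b₂ : ℝ, 0 < b₁ ∧ b₁ < b₂ ∧
      Filter.Tendsto
        (fun n : ℕ =>
          E0 d n (fun w => Real.exp (-β * (silt w : ℝ)) *
              (if ¬(b₁ * n ≤ (silt w : ℝ) ∧ (silt w : ℝ) ≤ b₂ * n) then 1 else 0)) /
          E0 d n (fun w => Real.exp (-β * (silt w : ℝ))))
        Filter.atTop (nhds 0) ∧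
      Filter.Tendsto
        (fun n : ℕ =>
          Ewsaw d n β
            (fun w => if b₁ * n ≤ (silt w : ℝ) ∧ (silt w : ℝ) ≤ b₂ * n then 1 else 0))
        Filter.atTop (nhds 1) := by
  have hd' : (0 : ℝ) < d := by exact_mod_cast hd
  obtain ⟨M, hM⟩ := exists_nat_ge (2 * (2 * d) ^ 2 * Real.exp (2 * β) + 4)
  have hM4 : (4 : ℝ) ≤ M := by
    have : 0 ≤ 2 * (2 * (d : ℝ)) ^ 2 * Real.exp (2 * β) := by positivity
    linarith
  have hM0 : 0 < 3 * M := by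
    have : (0 : ℝ) < M := by linarith
    have : 0 < M := by exact_mod_cast this
    omega
  have hM0' : (0 : ℝ) < 3 * M := by linarith
  have hlog : 0 ≤ Real.log (2 * d) := Real.log_nonneg (by
    have : (1 : ℝ) ≤ d := by exact_mod_cast hd
    linarith)
  set b₁ : ℝ := 1 / (3 * M) with hb₁
  set b₂ : ℝ := (Real.log (2 * d) + 1) / β + b₁ with hb₂
  have hb₁0 : 0 < b₁ := by positivity
  have hβb₂ : Real.log (2 * d) + 1 ≤ β * b₂ := by
    rw [hb₂, mul_add, mul_div_cancel₀ _ hβ.ne']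
    have := mul_pos hβ hb₁0
    linarith
  have hZ : ∀ n, 0 < wsawZ d n β := fun n => one_pos.trans_le (one_le_wsawZ hd n)
  set bad : ℕ → ℝ := fun n => ∑ w : Walk d n, Real.exp (-β * (silt w : ℝ)) *
    (if ¬(b₁ * n ≤ (silt w : ℝ) ∧ (silt w : ℝ) ≤ b₂ * n) then 1 else 0) with hbad
  have hbad_le : ∀ n, bad n ≤ wsawLow d n (n / (3 * M)) β +
      ∑ w : Walk d n with b₂ * n < silt w, Real.exp (-β * (silt w : ℝ)) := by
    intro n
    rw [wsawLow, Finset.sum_filter, Finset.sum_filter, ← Finset.sum_add_distrib]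
    refine Finset.sum_le_sum fun w _ => ?_
    have hE := (Real.exp_pos (-β * (silt w : ℝ))).le
    by_cases h1 : b₁ * n ≤ silt w
    · by_cases h2 : (silt w : ℝ) ≤ b₂ * n
      · simp only [h1, h2, and_self, not_true_eq_false, if_false, mul_zero]
        positivity
      · rw [if_pos (fun h => h2 h.2), if_pos (not_le.1 h2), mul_one]
        exact le_add_of_nonneg_left (by positivity)
    · have hlow : silt w ≤ n / (3 * M) := by
        rw [Nat.le_div_iff_mul_le hM0]
        rw [hb₁, not_le, one_div_mul_eq_div, lt_div_iff₀ hM0'] at h1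
        exact_mod_cast h1.le
      rw [if_pos (fun h => h1 h.1), if_pos hlow, mul_one]
      exact le_add_of_nonneg_right (by positivity)
  have hratio_le : ∀ n : ℕ, bad n / wsawZ d n β ≤
      (1 / 2 : ℝ) ^ (n / (3 * M)) + Real.exp (-1) ^ n := by
    intro n
    rw [div_le_iff₀ (hZ n), add_mul]
    refine (hbad_le n).trans (add_le_add (wsawLow_le_half_pow hd hβ hM ?_) ?_)
    · calc M * (n / (3 * M) + 2 * (n / (3 * M))) = 3 * M * (n / (3 * M)) := by ring
        _ ≤ n := Nat.mul_div_le _ _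
    · refine (sum_exp_silt_gt_le hd hβb₂ hβ n).trans ?_
      exact le_mul_of_one_le_right (by positivity) (one_le_wsawZ hd n)
  have hratio : Tendsto (fun n => bad n / wsawZ d n β) atTop (nhds 0) := by
    refine squeeze_zero (fun n => div_nonneg (Finset.sum_nonneg fun w _ => by positivity)
      (hZ n).le) hratio_le ?_
    have t1 := (tendsto_pow_atTop_nhds_zero_of_lt_one (r := (1 / 2 : ℝ)) (by norm_num)
      (by norm_num)).comp (Nat.tendsto_div_const_atTop hM0.ne')
    have t2 := tendsto_pow_atTop_nhds_zero_of_lt_one (Real.exp_pos (-1)).le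
      (by simp)
    simpa using t1.add t2
  refine ⟨b₁, b₂, hb₁0, lt_add_of_pos_left _ (by positivity), ?_, ?_⟩
  · refine hratio.congr fun n => ?_
    have hpow : ((2 * d : ℝ)) ^ n ≠ 0 := by positivity
    exact (div_div_div_cancel_right₀ hpow _ _).symm
  · have h1 : Tendsto (fun n => 1 - bad n / wsawZ d n β) atTop (nhds 1) := by
      simpa using hratio.const_sub 1
    refine h1.congr fun n => ?_
    rw [eq_comm, Ewsaw, ← wsawZ, eq_sub_iff_add_eq, ← add_div, div_eq_one_iff_eq (hZ n).ne',
      hbad, ← Finset.sum_add_distrib, wsawZ]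
    refine Finset.sum_congr rfl fun w _ => ?_
    by_cases h : b₁ * n ≤ (silt w : ℝ) ∧ (silt w : ℝ) ≤ b₂ * n <;> simp [h]
end

section
/- For the simple random walk in Z^d with d ≥ 3, there exists a positive finite constant c_d such that the expected self-intersection local time satisfies E₀(J_n) = (c_d + o(1)) · n as n → ∞; that is, lim_{n→∞} E₀(J_n)/n exists and is a positive real number. -/
open Filter

/-- The finite set of step sequences of length `k` whose steps sum to zero. -/
def closedWalks (d k : ℕ) : Finset (Walk d k) :=
  Finset.univ.filter fun v => ∀ c, ∑ j, stepVec d (v j) c = 0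

/-- The return probability `P₀(S(k) = 0)`. -/
noncomputable def returnProb (d k : ℕ) : ℝ :=
  ((closedWalks d k).card : ℝ) / (2 * d : ℝ) ^ k

lemma returnProb_nonneg (d k : ℕ) : 0 ≤ returnProb d k := by
  unfold returnProb; positivity

lemma walkPos_eq_walkPos_add_iff {d n : ℕ} (w : Walk d n) (i k : ℕ) (h : i + k ≤ n) :
    walkPos w i = walkPos w (i + k) ↔
      (fun j : Fin k => w ⟨i + j, by omega⟩) ∈ closedWalks d k := by
  have key : ∀ c, walkPos w (i + k) c =
      walkPos w i c + ∑ j : Fin k, stepVec d (w ⟨i + j, by omega⟩) c := by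
    intro c
    unfold walkPos
    rw [← Finset.sum_filter_add_sum_filter_not
      (Finset.univ.filter fun j : Fin n => (j : ℕ) < i + k) (fun j => (j : ℕ) < i)]
    congr 1
    · apply Finset.sum_congr _ fun _ _ => rfl
      ext j; simp; omega
    · symm
      refine Finset.sum_bij (fun (j : Fin k) _ => (⟨i + j, by omega⟩ : Fin n)) ?_ ?_ ?_ ?_
      · intro j _; simp
      · intro a _ b _ hab
        simp only [Fin.mk.injEq] at hab
        exact Fin.ext (by omega)
      · intro b hb
        simp only [Finset.mem_filter, Finset.mem_univ, true_and] at hb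
        exact ⟨⟨b - i, by omega⟩, Finset.mem_univ _, Fin.ext (by simp; omega)⟩
      · intro j _; rfl
  simp only [closedWalks, Finset.mem_filter, Finset.mem_univ, true_and]
  rw [funext_iff]
  refine forall_congr' fun c => ?_
  rw [key c]
  omega

lemma card_filter_comp_injective {α ι κ : Type*} [Fintype α] [Fintype ι] [Fintype κ]
    [DecidableEq ι] [DecidableEq κ] [DecidableEq α] (e : κ → ι) (he : Function.Injective e)
    (s : Finset (κ → α)) :
    (Finset.univ.filter fun w : ι → α => w ∘ e ∈ s).card =
      Fintype.card α ^ (Fintype.card ι - Fintype.card κ) * s.card := by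
  classical
  have hfib : ∀ v ∈ s, ((Finset.univ.filter fun w : ι → α => w ∘ e ∈ s).filter
      fun w => w ∘ e = v).card = Fintype.card α ^ (Fintype.card ι - Fintype.card κ) := by
    intro v hv
    have hset : ((Finset.univ.filter fun w : ι → α => w ∘ e ∈ s).filter fun w => w ∘ e = v) =
        Fintype.piFinset (fun i => if h : ∃ j, e j = i then {v h.choose} else Finset.univ) := by
      ext w
      simp only [Finset.mem_filter, Finset.mem_univ, true_and, Fintype.mem_piFinset]
      constructor
      · rintro ⟨-, rfl⟩ i
        split_ifs with h
        · simp [h.choose_spec]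
        · simp
      · intro hw
        have : w ∘ e = v := by
          ext j
          have h : ∃ j', e j' = e j := ⟨j, rfl⟩
          have := hw (e j)
          rw [dif_pos h, Finset.mem_singleton] at this
          rw [Function.comp_apply, this, he h.choose_spec]
        exact ⟨this ▸ hv, this⟩
    rw [hset, Fintype.card_piFinset]
    have : ∀ i, (if h : ∃ j, e j = i then {v h.choose} else (Finset.univ : Finset α)).card =
        if ∃ j, e j = i then 1 else Fintype.card α := by
      intro i; split_ifs <;> simp
    simp only [this]
    rw [Finset.prod_ite, Finset.prod_const_one, one_mul, Finset.prod_const]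
    congr 1
    rw [Finset.filter_not, Finset.card_sdiff_of_subset (Finset.filter_subset _ _)]
    congr 1
    rw [← Finset.card_univ (α := κ), ← Finset.card_image_of_injective _ he]
    congr 1
    ext i; simp
  rw [Finset.card_eq_sum_card_fiberwise (f := fun w => w ∘ e) (t := s)
    (fun w hw => by simpa using hw), Finset.sum_congr rfl hfib]
  simp [mul_comm]

lemma card_filter_walkPos_eq {d n i k : ℕ} (h : i + k ≤ n) :
    (Finset.univ.filter fun w : Walk d n => walkPos w i = walkPos w (i + k)).card =
      (2 * d) ^ (n - k) * (closedWalks d k).card := by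
  simp only [walkPos_eq_walkPos_add_iff _ i k h]
  have := card_filter_comp_injective (fun j : Fin k => (⟨i + j, by omega⟩ : Fin n))
    (fun a b hab => by
      simp only [Fin.mk.injEq] at hab
      exact Fin.ext (by omega)) (closedWalks d k)
  simp only [Fintype.card_prod, Fintype.card_fin, Fintype.card_bool] at this
  rw [mul_comm 2 d]
  exact this

lemma E0_silt_eq {d : ℕ} (hd : 0 < d) (n : ℕ) :
    E0 d n (fun w => (silt w : ℝ)) =
      ∑ j ∈ Finset.range n, ∑ m ∈ Finset.range (j + 1), returnProb d (m + 1) := by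
  have hprob : ∀ j ∈ Finset.range (n + 1), ∀ m ∈ Finset.range j,
      ((Finset.univ.filter fun w : Walk d n => walkPos w (j - (m + 1)) = walkPos w j).card : ℝ) /
        (2 * d : ℝ) ^ n = returnProb d (m + 1) := by
    intro j hj m hm
    rw [Finset.mem_range] at hj hm
    have h := card_filter_walkPos_eq (d := d) (n := n) (i := j - (m + 1)) (k := m + 1) (by omega)
    rw [Nat.sub_add_cancel (by omega)] at h
    rw [h, returnProb]
    have hd' : (0 : ℝ) < 2 * d := by positivity
    have : (2 * d : ℝ) ^ n = (2 * d) ^ (n - (m + 1)) * (2 * d) ^ (m + 1) := by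
      rw [← pow_add]; congr 1; omega
    rw [this]
    push_cast
    exact mul_div_mul_left _ _ (by positivity)
  have hsilt : ∀ w : Walk d n, (silt w : ℝ) = ∑ j ∈ Finset.range (n + 1),
      ∑ m ∈ Finset.range j, if walkPos w (j - (m + 1)) = walkPos w j then (1 : ℝ) else 0 := by
    intro w
    unfold silt
    rw [Finset.card_filter, Finset.sum_product_right]
    push_cast
    refine Finset.sum_congr rfl fun j hj => ?_
    rw [Finset.mem_range] at hj
    rw [← Finset.sum_subset (s₁ := Finset.range j)]
    · rw [← Finset.sum_range_reflect]
      refine Finset.sum_congr rfl fun i hi => ?_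
      rw [Finset.mem_range] at hi
      have h1 : j - 1 - i = j - (i + 1) := by omega
      have h2 : j - (i + 1) < j := by omega
      rw [h1]
      simp only [h2, true_and]
    · intro i hi
      simp only [Finset.mem_range] at hi ⊢
      omega
    · intro i _ hi
      simp only [Finset.mem_range] at hi
      simp [hi]
  unfold E0
  simp only [hsilt]
  rw [Finset.sum_comm, Finset.sum_div, Finset.sum_range_succ']
  simp only [Finset.range_zero, Finset.sum_empty, Finset.sum_const_zero, zero_div, add_zero]
  refine Finset.sum_congr rfl fun j hj => ?_
  rw [Finset.mem_range] at hj
  rw [Finset.sum_comm, Finset.sum_div]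
  refine Finset.sum_congr rfl fun m hm => ?_
  rw [Finset.sum_boole, hprob (j + 1) (by simpa using hj) m hm]

lemma card_closedWalks_le (d n : ℕ) :
    (closedWalks d n).card ≤ ∑ a : Fin n → Fin d, ∏ i,
      ((Finset.univ.filter fun j => a j = i).card).choose
        ((Finset.univ.filter fun j => a j = i).card / 2) := by
  rw [Finset.card_eq_sum_card_fiberwise (f := fun v : Walk d n => fun j => (v j).1)
    (t := Finset.univ) (fun _ _ => by simp)]
  refine Finset.sum_le_sum fun a _ => ?_
  have hpi : (Fintype.piFinset fun i => Finset.powersetCard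
      ((Finset.univ.filter fun j => a j = i).card / 2)
      (Finset.univ.filter fun j => a j = i)).card =
      ∏ i, ((Finset.univ.filter fun j => a j = i).card).choose
        ((Finset.univ.filter fun j => a j = i).card / 2) := by
    simp [Fintype.card_piFinset, Finset.card_powersetCard]
  rw [← hpi]
  refine Finset.card_le_card_of_injOn
    (fun v i => Finset.univ.filter fun j => a j = i ∧ (v j).2 = true) ?_ ?_
  · intro v hv
    simp only [closedWalks, Finset.coe_filter, Finset.mem_filter, Finset.mem_univ, true_and,
      Set.mem_ofPred_eq] at hv
    obtain ⟨hv, rfl⟩ := hv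
    rw [Finset.mem_coe, Fintype.mem_piFinset]
    intro i
    rw [Finset.mem_powersetCard]
    refine ⟨fun j hj => by simp at hj ⊢; exact hj.1, ?_⟩
    have h1 := Finset.card_filter_add_card_filter_not
      (s := Finset.univ.filter fun j => (v j).1 = i) (fun j => (v j).2 = true)
    rw [Finset.filter_filter, Finset.filter_filter] at h1
    have h2 := hv i
    have h3 : ∀ j, stepVec d (v j) i = (if (v j).1 = i ∧ (v j).2 = true then 1 else 0) -
        (if (v j).1 = i ∧ ¬ (v j).2 = true then 1 else 0) := by
      intro j
      unfold stepVec
      by_cases h : i = (v j).1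
      · cases h' : (v j).2 <;> simp [← h]
      · simp [h, Ne.symm h]
    simp only [h3, Finset.sum_sub_distrib, Finset.sum_boole] at h2
    dsimp only
    omega
  · intro v hv v' hv' heq
    simp only [Finset.coe_filter, Set.mem_ofPred_eq] at hv hv'
    have h1 := hv.2
    have h2 := hv'.2
    funext j
    refine Prod.ext ((congrFun h1 j).trans (congrFun h2 j).symm) ?_
    have := congrFun heq (a j)
    have := Finset.ext_iff.1 this j
    simp only [Finset.mem_filter, Finset.mem_univ, true_and] at this
    exact Bool.eq_iff_iff.2 this

/-- The largest point mass `C(k, ⌊k/2⌋) / 2^k` of the symmetric binomial law. -/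
noncomputable def middleMass (k : ℕ) : ℝ := (k.choose (k / 2) : ℝ) / 2 ^ k

lemma middleMass_nonneg (k : ℕ) : 0 ≤ middleMass k := by
  unfold middleMass; positivity

lemma middleMass_two_mul_sq_mul_le (m : ℕ) :
    middleMass (2 * m) ^ 2 * (2 * m + 1) ≤ 1 := by
  have hm : ∀ m, middleMass (2 * m) = (m.centralBinom : ℝ) / 4 ^ m := by
    intro m
    rw [middleMass, Nat.mul_div_cancel_left m two_pos, Nat.centralBinom, pow_mul]
    norm_num
  rw [hm]
  induction m with
  | zero => simp
  | succ m ih =>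
    have h : ((m : ℝ) + 1) * (m + 1).centralBinom = 2 * (2 * m + 1) * m.centralBinom := by
      exact_mod_cast Nat.succ_mul_centralBinom_succ m
    have h' : ((m + 1).centralBinom : ℝ) / 4 ^ (m + 1) =
        (2 * m + 1) / (2 * (m + 1)) * (m.centralBinom / 4 ^ m) := by
      field_simp
      rw [pow_succ]
      linear_combination (2 * 4 ^ m : ℝ) * h
    rw [h', mul_pow]
    have h2 : ((2 * (m : ℝ) + 1) / (2 * (m + 1))) ^ 2 * (2 * (m + 1 : ℕ) + 1) ≤ 2 * m + 1 := by
      rw [div_pow, div_mul_eq_mul_div, div_le_iff₀ (by positivity)]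
      push_cast
      have : (0 : ℝ) ≤ m := by positivity
      nlinarith
    calc _ = (m.centralBinom / 4 ^ m : ℝ) ^ 2 *
          (((2 * (m : ℝ) + 1) / (2 * (m + 1))) ^ 2 * (2 * (m + 1 : ℕ) + 1)) := by ring
      _ ≤ (m.centralBinom / 4 ^ m : ℝ) ^ 2 * (2 * m + 1) := by gcongr
      _ ≤ 1 := ih

lemma middleMass_sq_mul_le (k : ℕ) : middleMass k ^ 2 * (k + 1) ≤ 1 := by
  obtain ⟨m, rfl | rfl⟩ := Nat.even_or_odd' k
  · simpa using middleMass_two_mul_sq_mul_le m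
  · have h : middleMass (2 * m + 1) = middleMass (2 * (m + 1)) := by
      unfold middleMass
      rw [Nat.mul_div_cancel_left _ two_pos, show (2 * m + 1) / 2 = m by omega]
      have h1 : (2 * (m + 1)).choose (m + 1) = 2 * (2 * m + 1).choose m := by
        rw [show 2 * (m + 1) = 2 * m + 1 + 1 by ring, Nat.choose_succ_succ,
          ← Nat.choose_symm_half m]
        ring
      rw [h1, show 2 * (m + 1) = 2 * m + 1 + 1 by ring, pow_succ]
      push_cast
      field_simp
      ring
    have := middleMass_two_mul_sq_mul_le (m + 1)
    rw [h]
    refine le_trans ?_ this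
    push_cast
    gcongr ?_ * ?_
    linarith

lemma middleMass_le_one (k : ℕ) : middleMass k ≤ 1 := by
  have h := middleMass_sq_mul_le k
  have h0 := middleMass_nonneg k
  have : (0 : ℝ) ≤ k := by positivity
  nlinarith [mul_nonneg (sq_nonneg (middleMass k)) this]

lemma summable_middleMass_pow_three : Summable fun k => middleMass k ^ 3 := by
  have hs : Summable fun k : ℕ => 1 / ((k + 1 : ℕ) : ℝ) ^ (3 / 2 : ℝ) :=
    (summable_nat_add_iff 1).2 (Real.summable_one_div_nat_rpow.2 (by norm_num))
  refine Summable.of_nonneg_of_le (fun k => pow_nonneg (middleMass_nonneg k) 3) (fun k => ?_) hs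
  have h0 := middleMass_nonneg k
  have hk : (0 : ℝ) < ((k + 1 : ℕ) : ℝ) := by positivity
  have h : middleMass k ^ 2 ≤ ((k + 1 : ℕ) : ℝ)⁻¹ := by
    rw [← one_div, le_div_iff₀ hk]
    simpa using middleMass_sq_mul_le k
  calc middleMass k ^ 3 = (middleMass k ^ 2) ^ (3 / 2 : ℝ) := by
        rw [← Real.rpow_natCast, ← Real.rpow_natCast, ← Real.rpow_mul h0]
        norm_num
    _ ≤ (((k + 1 : ℕ) : ℝ)⁻¹) ^ (3 / 2 : ℝ) := by gcongr
    _ = _ := by rw [Real.inv_rpow hk.le, one_div]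

lemma prod_le_sum_pow_three {ι : Type*} [Fintype ι] (hι : 3 ≤ Fintype.card ι) (x : ι → ℝ)
    (h0 : ∀ i, 0 ≤ x i) (h1 : ∀ i, x i ≤ 1) : ∏ i, x i ≤ ∑ i, x i ^ 3 := by
  have : Nonempty ι := Fintype.card_pos_iff.1 (by omega)
  obtain ⟨i₀, h⟩ := Finite.exists_max x
  calc ∏ i, x i ≤ ∏ _i : ι, x i₀ := Finset.prod_le_prod (fun i _ => h0 i) fun i _ => h i
    _ = x i₀ ^ Fintype.card ι := by simp
    _ ≤ x i₀ ^ 3 := pow_le_pow_of_le_one (h0 _) (h1 _) hι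
    _ ≤ ∑ i, x i ^ 3 := Finset.single_le_sum (f := fun i => x i ^ 3)
        (fun i _ => pow_nonneg (h0 i) 3) (Finset.mem_univ i₀)

/-- The mean of `h` at the number of visits to `i` among `n` uniform choices from `Fin d`. -/
noncomputable def occupationMean (d : ℕ) (i : Fin d) (n : ℕ) (h : ℕ → ℝ) : ℝ :=
  (∑ a : Fin n → Fin d, h (Finset.univ.filter fun j => a j = i).card) / (d : ℝ) ^ n

lemma occupationMean_zero {d : ℕ} (i : Fin d) (h : ℕ → ℝ) : occupationMean d i 0 h = h 0 := by
  simp [occupationMean]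

lemma occupationMean_succ {d : ℕ} (i : Fin d) (n : ℕ) (h : ℕ → ℝ) :
    occupationMean d i (n + 1) h = (1 - 1 / d) * occupationMean d i n h +
      1 / d * occupationMean d i n (fun k => h (k + 1)) := by
  have hd : (d : ℝ) ≠ 0 := by
    have := i.pos
    positivity
  have hsum : ∑ a : Fin (n + 1) → Fin d, h (Finset.univ.filter fun j => a j = i).card =
      (d - 1) * ∑ a : Fin n → Fin d, h (Finset.univ.filter fun j => a j = i).card +
        ∑ a : Fin n → Fin d, h ((Finset.univ.filter fun j => a j = i).card + 1) := by
    rw [← (Fin.consEquiv fun _ => Fin d).sum_comp, Fintype.sum_prod_type,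
      ← Finset.add_sum_erase _ _ (Finset.mem_univ i), add_comm]
    congr 1
    · have : ∀ x ∈ Finset.univ.erase i, (∑ a : Fin n → Fin d,
          h (Finset.univ.filter fun j => (Fin.consEquiv fun _ => Fin d) (x, a) j = i).card) =
          ∑ a : Fin n → Fin d, h (Finset.univ.filter fun j => a j = i).card := by
        intro x hx
        have hx' : x ≠ i := Finset.ne_of_mem_erase hx
        refine Finset.sum_congr rfl fun a _ => ?_
        rw [Fin.card_filter_univ_succ]
        simp [Fin.consEquiv, hx']
      rw [Finset.sum_congr rfl this, Finset.sum_const, Finset.card_erase_of_mem (Finset.mem_univ i),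
        nsmul_eq_mul, Finset.card_univ, Fintype.card_fin, Nat.cast_sub i.pos, Nat.cast_one]
    · refine Finset.sum_congr rfl fun a _ => ?_
      rw [Fin.card_filter_univ_succ]
      simp [Fin.consEquiv]
  unfold occupationMean
  rw [hsum, pow_succ]
  field_simp

lemma sum_occupationMean_le {d : ℕ} (i : Fin d) (N : ℕ) (h : ℕ → ℝ) (h0 : ∀ k, 0 ≤ h k)
    (hs : Summable h) : ∑ n ∈ Finset.range N, occupationMean d i n h ≤ d * ∑' k, h k := by
  have hd : (1 : ℝ) ≤ d := by exact_mod_cast i.pos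
  induction N generalizing h with
  | zero => simpa using mul_nonneg (by linarith) (tsum_nonneg h0)
  | succ N ih =>
    have h1 := ih h h0 hs
    have h2 := ih (fun k => h (k + 1)) (fun k => h0 _) ((summable_nat_add_iff 1).2 hs)
    rw [Finset.sum_range_succ']
    simp only [occupationMean_succ, occupationMean_zero, Finset.sum_add_distrib,
      ← Finset.mul_sum]
    have h3 := hs.tsum_eq_zero_add
    have hd' : (1 : ℝ) / d ≤ 1 := by rw [div_le_one (by linarith)]; exact hd
    calc _ ≤ (1 - 1 / (d : ℝ)) * (d * ∑' k, h k) + 1 / d * (d * ∑' k, h (k + 1)) + h 0 := by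
          gcongr
      _ = d * ∑' k, h k := by
          rw [h3]
          field_simp
          ring

lemma returnProb_le {d : ℕ} (hd : 3 ≤ d) (n : ℕ) :
    returnProb d n ≤ ∑ i, occupationMean d i n (fun k => middleMass k ^ 3) := by
  have hd' : (0 : ℝ) < d := by positivity
  unfold occupationMean returnProb
  rw [← Finset.sum_div, Finset.sum_comm, mul_pow, ← div_div]
  gcongr
  rw [div_le_iff₀ (by positivity), Finset.sum_mul]
  refine (Nat.cast_le.2 (card_closedWalks_le d n)).trans ?_
  push_cast
  refine Finset.sum_le_sum fun a _ => ?_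
  have hn : n = ∑ i, (Finset.univ.filter fun j => a j = i).card := by
    rw [← Finset.card_eq_sum_card_fiberwise (fun _ _ => by simp)]
    simp
  have hprod : ∏ i, (((Finset.univ.filter fun j => a j = i).card).choose
        ((Finset.univ.filter fun j => a j = i).card / 2) : ℝ) =
      (∏ i, middleMass (Finset.univ.filter fun j => a j = i).card) * 2 ^ n := by
    have h2 : (2 : ℝ) ^ n = ∏ i, 2 ^ (Finset.univ.filter fun j => a j = i).card := by
      rw [Finset.prod_pow_eq_pow_sum, ← hn]
    rw [h2, ← Finset.prod_mul_distrib]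
    refine Finset.prod_congr rfl fun i _ => ?_
    rw [middleMass, div_mul_cancel₀ _ (by positivity)]
  rw [hprod]
  gcongr
  exact prod_le_sum_pow_three (by simpa using hd) _ (fun _ => middleMass_nonneg _)
    fun _ => middleMass_le_one _

/-- The simple random walk on `ℤ^d` is transient for `d ≥ 3`. -/
lemma summable_returnProb {d : ℕ} (hd : 3 ≤ d) : Summable (returnProb d) := by
  refine summable_of_sum_range_le (c := ∑ _i : Fin d, d * ∑' k, middleMass k ^ 3)
    (returnProb_nonneg d) fun N => ?_
  calc ∑ n ∈ Finset.range N, returnProb d n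
      ≤ ∑ n ∈ Finset.range N, ∑ i, occupationMean d i n (fun k => middleMass k ^ 3) :=
        Finset.sum_le_sum fun n _ => returnProb_le hd n
    _ = ∑ i, ∑ n ∈ Finset.range N, occupationMean d i n (fun k => middleMass k ^ 3) :=
        Finset.sum_comm
    _ ≤ _ := Finset.sum_le_sum fun i _ => sum_occupationMean_le i N _
        (fun k => pow_nonneg (middleMass_nonneg k) 3) summable_middleMass_pow_three

lemma returnProb_two_pos {d : ℕ} (hd : 0 < d) : 0 < returnProb d 2 := by
  have : (closedWalks d 2).Nonempty := by
    refine ⟨![(⟨0, hd⟩, true), (⟨0, hd⟩, false)], ?_⟩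
    simp only [closedWalks, Finset.mem_filter, Finset.mem_univ, true_and]
    intro c
    simp only [Fin.sum_univ_two, stepVec, Matrix.cons_val_zero, Matrix.cons_val_one]
    split_ifs <;> simp_all
  have := this.card_pos
  unfold returnProb
  positivity

/-- for the simple random walk in `ℤ^d`, `d ≥ 3`, there is a
positive constant `c_d` with `E₀(J_n) = (c_d + o(1)) n`. -/
theorem srw_silt_high_dim (d : ℕ) (hd : 3 ≤ d) :
    ∃ c : ℝ, 0 < c ∧
      Filter.Tendsto (fun n : ℕ => E0 d n (fun w => (silt w : ℝ)) / (n : ℝ))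
        Filter.atTop (nhds c) := by
  have hs : Summable fun m => returnProb d (m + 1) :=
    (summable_nat_add_iff 1).2 (summable_returnProb hd)
  refine ⟨∑' m, returnProb d (m + 1), hs.tsum_pos (fun m => returnProb_nonneg d _) 1
    (returnProb_two_pos (by omega)), ?_⟩
  have ht := ((tendsto_add_atTop_iff_nat 1).2 hs.hasSum.tendsto_sum_nat).cesaro
  refine ht.congr fun n => ?_
  rw [E0_silt_eq (by omega), div_eq_inv_mul]
end
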